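/- For every integer k ≥ 2, the space P_{k-2}(ℝ³;𝕊) is the internal direct sum of the subspace { inc τ : τ ∈ P_k(ℝ³;𝕊) } and the subspace { x ↦ sym( v(x) xᵀ ) : v ∈ P_{k-3}(ℝ³;ℝ³) }. -/

import Mathlib

open Matrix

noncomputable section

abbrev V3 : Type := Fin 3 → ℝ
abbrev M3 : Type := Matrix (Fin 3) (Fin 3) ℝ

/-- The Levi-Civita symbol `ε i j k` on `Fin 3`. -/
def eps (i j k : Fin 3) : ℝ :=
  ((((j : ℤ) - (i : ℤ)) * ((k : ℤ) - (j : ℤ)) * ((k : ℤ) - (i : ℤ)) : ℤ) : ℝ) / 2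

/-- Partial derivative `∂ᵢ f`. -/
def pd (i : Fin 3) (f : V3 → ℝ) : V3 → ℝ :=
  fun x => fderiv ℝ f x (Pi.single i 1)

/-- Cross product of vectors in `ℝ³`. -/
def vcross (a b : V3) : V3 := fun i => ∑ k, ∑ l, eps i k l * a k * b l

/-- Symmetric part of a matrix, `sym B = (B + Bᵀ)/2`. -/
def symMat (B : M3) : M3 := (2:ℝ)⁻¹ • (B + Bᵀ)

/-- `(∇v)_{ij} = ∂ᵢ v_j`. -/
def gradv (v : V3 → V3) : V3 → M3 :=
  fun x => Matrix.of fun i j => pd i (fun y => v y j) x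

/-- Symmetric gradient (deformation) `def v = (∇v + (∇v)ᵀ)/2`. -/
def defv (v : V3 → V3) : V3 → M3 := fun x => symMat (gradv v x)

/-- Column-wise curl `(∇×A)_{ij} = Σ_{s,t} ε_{ist} ∂_s A_{tj}`. -/
def colCurl (A : V3 → M3) : V3 → M3 :=
  fun x => Matrix.of fun i j => ∑ s, ∑ t, eps i s t * pd s (fun y => A y t j) x

/-- Row-wise curl `(A×∇)_{ij} = Σ_{k,l} ε_{jkl} ∂_l A_{ik}`. -/
def rowCurl (A : V3 → M3) : V3 → M3 :=
  fun x => Matrix.of fun i j => ∑ k, ∑ l, eps j k l * pd l (fun y => A y i k) x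

/-- Incompatibility operator `inc A = ∇×(A×∇)`. -/
def incOp (A : V3 → M3) : V3 → M3 := colCurl (rowCurl A)

/-- Row-wise divergence `(div A)_i = Σ_j ∂_j A_{ij}`. -/
def divRow (A : V3 → M3) : V3 → V3 :=
  fun x i => ∑ j, pd j (fun y => A y i j) x

/-- Curl of a vector field. -/
def curlVec (w : V3 → V3) : V3 → V3 :=
  fun x i => ∑ s, ∑ t, eps i s t * pd s (fun y => w y t) x

/-- `(b×A)_{ij} = Σ_{k,l} ε_{ikl} b_k A_{lj}`. -/
def bCrossA (b : V3) (A : M3) : M3 :=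
  Matrix.of fun i j => ∑ k, ∑ l, eps i k l * b k * A l j

/-- `(A×b)_{ij} = Σ_{k,l} ε_{jkl} A_{ik} b_l`. -/
def aCrossB (A : M3) (b : V3) : M3 :=
  Matrix.of fun i j => ∑ k, ∑ l, eps j k l * A i k * b l

/-- `f : ℝ³ → ℝ` is a polynomial map of total degree at most `m` (`m : ℤ`, so
`m < 0` forces `f = 0` since the zero polynomial has empty support). -/
def PolyDeg (m : ℤ) (f : V3 → ℝ) : Prop :=
  ∃ p : MvPolynomial (Fin 3) ℝ,
    (∀ d ∈ p.support, ((∑ i, d i : ℕ) : ℤ) ≤ m) ∧ f = fun x => MvPolynomial.eval x p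

/-- `P_m(ℝ³;ℝ³)`. -/
def PolyVec (m : ℤ) (v : V3 → V3) : Prop := ∀ i, PolyDeg m fun x => v x i

/-- `P_m(ℝ³;𝕄)`. -/
def PolyMat (m : ℤ) (A : V3 → M3) : Prop := ∀ i j, PolyDeg m fun x => A x i j

/-- `P_m(ℝ³;𝕊)`: polynomial symmetric-matrix-valued maps of degree at most `m`. -/
def PolySym (m : ℤ) (A : V3 → M3) : Prop := PolyMat m A ∧ ∀ x, (A x)ᵀ = A x

open MvPolynomial

abbrev P3 : Type := MvPolynomial (Fin 3) ℝ

theorem hasFDerivAt_eval (p : P3) (x : V3) :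
    HasFDerivAt (fun y : V3 => eval y p)
      (∑ i, eval x (pderiv i p) • (ContinuousLinearMap.proj i : V3 →L[ℝ] ℝ)) x := by
  induction p using MvPolynomial.induction_on with
  | C a => simpa using hasFDerivAt_const a x
  | add p q hp hq =>
    simp only [map_add, add_smul, Finset.sum_add_distrib]
    exact hp.add hq
  | mul_X p j hp =>
    have h := hp.mul (hasFDerivAt_apply (𝕜 := ℝ) j x)
    simp only [map_mul, eval_X]
    refine h.congr_fderiv ?_
    ext v
    simp [pderiv_X, Fin.sum_univ_three]
    fin_cases j <;> simp <;> ring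

theorem pd_eval (i : Fin 3) (p : P3) :
    pd i (fun y => eval y p) = fun x => eval x (pderiv i p) := by
  funext x
  simp [pd, (hasFDerivAt_eval p x).fderiv, Pi.single_apply]

theorem pderiv_comm (i j : Fin 3) (p : P3) :
    pderiv i (pderiv j p) = pderiv j (pderiv i p) := by
  have : ⁅(pderiv i : Derivation ℝ P3 P3), (pderiv j : Derivation ℝ P3 P3)⁆ = 0 := by
    apply MvPolynomial.derivation_ext
    intro k
    simp [Derivation.commutator_apply, pderiv_X, Pi.single_apply, apply_ite]
  have := congrArg (fun D => D p) this
  simpa [Derivation.commutator_apply, sub_eq_zero] using this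

/-- The Euler operator `∑ xᵢ ∂ᵢ`. -/
def euler (p : P3) : P3 := ∑ i, X i * pderiv i p

/-- The inverse of `euler + c`, for `c > 0`. -/
def eulerInv (c : ℝ) : P3 →ₗ[ℝ] P3 :=
  (basisMonomials (Fin 3) ℝ).constr ℝ fun d => monomial d ((d.degree : ℝ) + c)⁻¹

theorem eulerInv_monomial (c : ℝ) (d : Fin 3 →₀ ℕ) (a : ℝ) :
    eulerInv c (monomial d a) = monomial d (((d.degree : ℝ) + c)⁻¹ * a) := by
  have h : (monomial d a : P3) = a • basisMonomials (Fin 3) ℝ d := by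
    simp [smul_monomial]
  rw [h, map_smul, eulerInv, Module.Basis.constr_basis, smul_monomial, smul_eq_mul, mul_comm]

theorem coeff_eulerInv (c : ℝ) (d : Fin 3 →₀ ℕ) (p : P3) :
    coeff d (eulerInv c p) = ((d.degree : ℝ) + c)⁻¹ * coeff d p := by
  induction p using MvPolynomial.induction_on' with
  | monomial e a =>
    rw [eulerInv_monomial, coeff_monomial, coeff_monomial]
    split_ifs with h <;> simp [h]
  | add p q hp hq => simp [hp, hq, mul_add]

theorem euler_monomial (d : Fin 3 →₀ ℕ) (a : ℝ) :
    euler (monomial d a) = monomial d ((d.degree : ℝ) * a) := by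
  have := (isHomogeneous_monomial a (rfl : d.degree = d.degree)).sum_X_mul_pderiv
  rw [euler, this]
  rw [← smul_eq_mul, ← smul_monomial, Nat.cast_smul_eq_nsmul]

theorem coeff_euler (d : Fin 3 →₀ ℕ) (p : P3) :
    coeff d (euler p) = (d.degree : ℝ) * coeff d p := by
  induction p using MvPolynomial.induction_on' with
  | monomial e a =>
    rw [euler_monomial, coeff_monomial, coeff_monomial]
    split_ifs with h <;> simp [h]
  | add p q hp hq =>
    have : euler (p + q) = euler p + euler q := by
      simp [euler, mul_add, Finset.sum_add_distrib]
    simp [this, hp, hq, mul_add]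

theorem euler_eulerInv {c : ℝ} (hc : 0 < c) (p : P3) :
    euler (eulerInv c p) + C c * eulerInv c p = p := by
  ext d
  have : (d.degree : ℝ) + c ≠ 0 := by positivity
  rw [coeff_add, coeff_C_mul, coeff_euler, coeff_eulerInv]
  field_simp

theorem eulerInv_euler {c : ℝ} (hc : 0 < c) (p : P3) :
    eulerInv c (euler p + C c * p) = p := by
  ext d
  have : (d.degree : ℝ) + c ≠ 0 := by positivity
  rw [coeff_eulerInv, coeff_add, coeff_C_mul, coeff_euler]
  field_simp

theorem pderiv_eulerInv (c : ℝ) (i : Fin 3) (p : P3) :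
    pderiv i (eulerInv c p) = eulerInv (c + 1) (pderiv i p) := by
  ext d
  have h : ((d + Finsupp.single i 1).degree : ℝ) = d.degree + 1 := by
    simp [map_add]
  simp only [coeff_eulerInv, coeff_pderiv, h]
  ring_nf

/-- Polynomials of total degree at most `m`, for an integer `m`. -/
def polyLE (m : ℤ) : Submodule ℝ P3 where
  carrier := {p | ∀ d, coeff d p ≠ 0 → ((∑ i, d i : ℕ) : ℤ) ≤ m}
  zero_mem' := by simp
  add_mem' {p q} hp hq d hd := by
    by_cases h : coeff d p = 0
    · exact hq d (by simpa [h] using hd)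
    · exact hp d h
  smul_mem' a p hp d hd := hp d fun h => hd (by simp [h])

theorem mem_polyLE {m : ℤ} {p : P3} :
    p ∈ polyLE m ↔ ∀ d, coeff d p ≠ 0 → ((∑ i, d i : ℕ) : ℤ) ≤ m := Iff.rfl

theorem eulerInv_mem {m : ℤ} {p : P3} (c : ℝ) (hp : p ∈ polyLE m) : eulerInv c p ∈ polyLE m :=
  fun d hd => hp d fun h => hd (by simp [coeff_eulerInv, h])

theorem C_mul_mem {m : ℤ} {p : P3} (c : ℝ) (hp : p ∈ polyLE m) : C c * p ∈ polyLE m := by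
  rw [C_mul']
  exact (polyLE m).smul_mem c hp

theorem pderiv_mem {m n : ℤ} (hmn : m = n + 1) {p : P3} (i : Fin 3) (hp : p ∈ polyLE m) :
    pderiv i p ∈ polyLE n := by
  intro d hd
  rw [coeff_pderiv] at hd
  have := hp _ (left_ne_zero_of_mul hd)
  simp [Finset.sum_add_distrib] at this
  push_cast
  omega

theorem X_mul_mem {m n : ℤ} (hmn : n = m + 1) {p : P3} (i : Fin 3) (hp : p ∈ polyLE m) :
    X i * p ∈ polyLE n := by
  intro d hd
  rw [coeff_X_mul'] at hd
  split_ifs at hd with h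
  · have := hp _ hd
    have h1 : d = (d - Finsupp.single i 1) + Finsupp.single i 1 := by
      rw [tsub_add_cancel_of_le]
      simpa [Nat.one_le_iff_ne_zero] using h
    rw [h1]
    generalize d - Finsupp.single i 1 = e at *
    simp [Finset.sum_add_distrib]
    push_cast at this
    omega
  · exact absurd rfl hd

theorem polyDeg_iff {m : ℤ} {f : V3 → ℝ} :
    PolyDeg m f ↔ ∃ p ∈ polyLE m, f = fun x => eval x p := by
  simp only [PolyDeg, mem_polyLE, MvPolynomial.mem_support_iff]

/-- The incompatibility operator on matrices of polynomials. -/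
def incPoly : Matrix (Fin 3) (Fin 3) P3 →ₗ[ℝ] Matrix (Fin 3) (Fin 3) P3 where
  toFun P := Matrix.of fun i j => ∑ s, ∑ t, C (eps i s t) *
    pderiv s (∑ k, ∑ l, C (eps j k l) * pderiv l (P t k))
  map_add' P Q := by
    ext1 i j
    simp only [of_apply, Matrix.add_apply, map_add, mul_add, Finset.sum_add_distrib]
  map_smul' a P := by
    ext1 i j
    simp only [of_apply, Matrix.smul_apply, Derivation.map_smul, mul_smul_comm, ← Finset.smul_sum,
      RingHom.id_apply]

/-- The Koszul operator `x × P × x`, obtained from `incPoly` by replacing `∂` with `x`. -/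
def koszul (P : Matrix (Fin 3) (Fin 3) P3) : Matrix (Fin 3) (Fin 3) P3 :=
  Matrix.of fun i j => ∑ s, ∑ t, C (eps i s t) *
    (X s * ∑ k, ∑ l, C (eps j k l) * (X l * P t k))

/-- Row-wise divergence of a matrix of polynomials. -/
def divPoly (P : Matrix (Fin 3) (Fin 3) P3) : Fin 3 → P3 := fun i => ∑ j, pderiv j (P i j)

/-- The matrix of polynomials `sym (v xᵀ)`. -/
def symVecX : (Fin 3 → P3) →ₗ[ℝ] Matrix (Fin 3) (Fin 3) P3 where
  toFun v := Matrix.of fun i j => C 2⁻¹ * (v i * X j + v j * X i)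
  map_add' v w := by ext1 i j; simp; ring
  map_smul' a v := by ext1 i j; simp [smul_eq_C_mul]; ring

theorem eps_values :
    eps 0 1 2 = 1 ∧ eps 1 2 0 = 1 ∧ eps 2 0 1 = 1 ∧
    eps 0 2 1 = -1 ∧ eps 2 1 0 = -1 ∧ eps 1 0 2 = -1 := by
  refine ⟨?_, ?_, ?_, ?_, ?_, ?_⟩ <;> norm_num [eps]

theorem eps_self_left (i k : Fin 3) : eps i i k = 0 := by simp [eps]

theorem eps_self_right (i k : Fin 3) : eps i k k = 0 := by simp [eps]

theorem eps_self_outer (i k : Fin 3) : eps i k i = 0 := by simp [eps]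

theorem divPoly_incPoly (P : Matrix (Fin 3) (Fin 3) P3) : divPoly (incPoly P) = 0 := by
  obtain ⟨h1, h2, h3, h4, h5, h6⟩ := eps_values
  have c10 := pderiv_comm 1 0
  have c20 := pderiv_comm 2 0
  have c21 := pderiv_comm 2 1
  funext i
  fin_cases i <;>
  · simp [divPoly, incPoly, Fin.sum_univ_three, h1, h2, h3, h4, h5, h6, eps_self_left,
      eps_self_right, eps_self_outer, c10, c20, c21]
    try ring

set_option maxHeartbeats 2000000 in
theorem incPoly_koszul {P : Matrix (Fin 3) (Fin 3) P3} (hP : ∀ i j, P i j = P j i)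
    (hdiv : divPoly P = 0) (i j : Fin 3) :
    incPoly (koszul P) i j =
      euler (euler (P i j) + C 2 * P i j) + C 3 * (euler (P i j) + C 2 * P i j) := by
  obtain ⟨h1, h2, h3, h4, h5, h6⟩ := eps_values
  have c10 := pderiv_comm 1 0
  have c20 := pderiv_comm 2 0
  have c21 := pderiv_comm 2 1
  have s10 := hP 1 0
  have s20 := hP 2 0
  have s21 := hP 2 1
  have d (i) : pderiv 2 (P i 2) = -pderiv 0 (P i 0) - pderiv 1 (P i 1) := by
    have := congrFun hdiv i
    simp only [divPoly, Fin.sum_univ_three, Pi.zero_apply] at this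
    linear_combination this
  have d0 := d 0
  have d1 := d 1
  have d2 := d 2
  rw [s10] at d1
  rw [s20, s21] at d2
  have X10 : pderiv 1 (X 0 : P3) = 0 := pderiv_X_of_ne (by decide)
  have X20 : pderiv 2 (X 0 : P3) = 0 := pderiv_X_of_ne (by decide)
  have X01 : pderiv 0 (X 1 : P3) = 0 := pderiv_X_of_ne (by decide)
  have X21 : pderiv 2 (X 1 : P3) = 0 := pderiv_X_of_ne (by decide)
  have X02 : pderiv 0 (X 2 : P3) = 0 := pderiv_X_of_ne (by decide)
  have X12 : pderiv 1 (X 2 : P3) = 0 := pderiv_X_of_ne (by decide)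
  have C2 : (C 2 : P3) = 2 := map_ofNat C 2
  have C3 : (C 3 : P3) = 3 := map_ofNat C 3
  have D2 (i) : pderiv i (2 : P3) = 0 := by rw [← C2, pderiv_C]
  fin_cases i <;> fin_cases j <;>
  · simp [incPoly, koszul, euler, Fin.sum_univ_three, h1, h2, h3, h4, h5, h6, eps_self_left,
      eps_self_right, eps_self_outer, c10, c20, c21, s10, s20, s21, d0, d1, d2,
      X10, X20, X01, X21, X02, X12, C2, C3, D2]
    ring

theorem eq_zero_of_euler_add_eq_zero {c : ℝ} (hc : 0 < c) {p : P3} (h : euler p + C c * p = 0) :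
    p = 0 := by
  rw [← eulerInv_euler hc p, h, map_zero]

theorem pderiv_euler (i : Fin 3) (p : P3) :
    pderiv i (euler p) = euler (pderiv i p) + pderiv i p := by
  simp only [euler, Fin.sum_univ_three, map_add, Derivation.leibniz, smul_eq_mul, pderiv_X]
  rw [pderiv_comm i 0, pderiv_comm i 1, pderiv_comm i 2]
  fin_cases i <;> simp <;> ring

theorem divPoly_add (P Q : Matrix (Fin 3) (Fin 3) P3) :
    divPoly (P + Q) = divPoly P + divPoly Q := by
  funext i
  simp [divPoly, Finset.sum_add_distrib]

theorem sum_pderiv_X_mul (p : P3) : ∑ i, pderiv i (X i * p) = euler p + C 3 * p := by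
  have C3 : (C 3 : P3) = 3 := map_ofNat C 3
  simp [euler, Fin.sum_univ_three, C3]
  ring

theorem divPoly_symVecX (v : Fin 3 → P3) (i : Fin 3) :
    divPoly (symVecX v) i =
      C 2⁻¹ * (euler (v i) + C 4 * v i + X i * ∑ j, pderiv j (v j)) := by
  have C4 : (C 4 : P3) = 4 := map_ofNat C 4
  simp only [divPoly, symVecX, LinearMap.coe_mk, AddHom.coe_mk, of_apply, pderiv_C_mul, C4]
  rw [← Finset.mul_sum]
  congr 1
  simp only [euler, Fin.sum_univ_three, map_add, Derivation.leibniz, smul_eq_mul, pderiv_X]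
  fin_cases i <;> simp <;> ring

theorem eq_zero_of_divPoly_symVecX_eq_zero {v : Fin 3 → P3} (h : divPoly (symVecX v) = 0) : v = 0 := by
  have h1 (i) : euler (v i) + C 4 * v i + X i * ∑ j, pderiv j (v j) = 0 := by
    have := congrFun h i
    rw [divPoly_symVecX] at this
    rcases mul_eq_zero.mp this with h | h
    · norm_num [C_eq_zero] at h
    · exact h
  set d := ∑ j, pderiv j (v j) with hd
  have h2 : euler d + C 4 * d = 0 := by
    have h3 : ∑ i, pderiv i (euler (v i) + C 4 * v i + X i * d) = 0 := by simp [h1]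
    simp only [map_add, Finset.sum_add_distrib, sum_pderiv_X_mul, pderiv_C_mul, pderiv_euler,
      ← Finset.mul_sum, ← hd] at h3
    have h4 : ∑ i, euler (pderiv i (v i)) = euler d := by
      simp [hd, euler, Fin.sum_univ_three]
      ring
    have C4 : (C 4 : P3) = 4 := map_ofNat C 4
    have C3 : (C 3 : P3) = 3 := map_ofNat C 3
    have C2 : C 2⁻¹ * (2 : P3) = 1 := by
      rw [← map_ofNat C 2, ← C_mul]
      norm_num
    rw [h4, C4, C3] at h3
    rw [C4]
    linear_combination C 2⁻¹ * h3 - (euler d + 4 * d) * C2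
  have hd0 := eq_zero_of_euler_add_eq_zero four_pos h2
  funext i
  apply eq_zero_of_euler_add_eq_zero four_pos
  simpa [hd0] using h1 i

theorem exists_divPoly_symVecX_eq {m : ℤ} {w : Fin 3 → P3} (hw : ∀ i, w i ∈ polyLE m) :
    ∃ v : Fin 3 → P3, (∀ i, v i ∈ polyLE m) ∧ divPoly (symVecX v) = w := by
  have C2 : (C 2 : P3) = 2 := map_ofNat C 2
  have C3 : (C 3 : P3) = 3 := map_ofNat C 3
  have C4 : (C 4 : P3) = 4 := map_ofNat C 4
  have C5 : (C 5 : P3) = 5 := map_ofNat C 5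
  set d := eulerInv 4 (∑ i, pderiv i (w i)) with hd
  have hd' : euler d + C 4 * d = ∑ i, pderiv i (w i) := euler_eulerInv four_pos _
  set v : Fin 3 → P3 := fun i => eulerInv 4 (C 2 * w i - X i * d) with hv
  have hdiv : ∑ i, pderiv i (v i) = d := by
    simp only [hv, pderiv_eulerInv, map_sub, ← map_sum, pderiv_C_mul, Finset.sum_sub_distrib,
      sum_pderiv_X_mul, ← Finset.mul_sum, ← hd']
    rw [← map_sub]
    norm_num1
    rw [← eulerInv_euler (show (0 : ℝ) < 5 by norm_num) d]
    congr 1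
    rw [eulerInv_euler (show (0 : ℝ) < 5 by norm_num) d, C2, C3, C4, C5]
    ring
  refine ⟨v, fun i => eulerInv_mem _ (sub_mem (C_mul_mem _ (hw i)) ?_), ?_⟩
  · refine X_mul_mem (m := m - 1) (by ring) i (eulerInv_mem _ (sum_mem fun j _ => ?_))
    exact pderiv_mem (by ring) j (hw j)
  · funext i
    rw [divPoly_symVecX, hdiv, euler_eulerInv four_pos, sub_add_cancel, ← mul_assoc, ← C_mul]
    norm_num

/-- Symmetric matrices of polynomials of total degree at most `m`. -/
def symPolyLE (m : ℤ) : Submodule ℝ (Matrix (Fin 3) (Fin 3) P3) where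
  carrier := {P | (∀ i j, P i j ∈ polyLE m) ∧ ∀ i j, P i j = P j i}
  zero_mem' := ⟨fun _ _ => zero_mem _, fun _ _ => rfl⟩
  add_mem' hP hQ := ⟨fun i j => add_mem (hP.1 i j) (hQ.1 i j), fun i j =>
    congrArg₂ (· + ·) (hP.2 i j) (hQ.2 i j)⟩
  smul_mem' a _ hP := ⟨fun i j => Submodule.smul_mem _ a (hP.1 i j), fun i j =>
    congrArg (a • ·) (hP.2 i j)⟩

/-- Vectors of polynomials of total degree at most `m`. -/
def vecPolyLE (m : ℤ) : Submodule ℝ (Fin 3 → P3) := Submodule.pi Set.univ fun _ => polyLE m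

theorem mem_vecPolyLE {m : ℤ} {v : Fin 3 → P3} : v ∈ vecPolyLE m ↔ ∀ i, v i ∈ polyLE m := by
  simp [vecPolyLE]

theorem koszul_mem {m n : ℤ} (hmn : n = m + 2) {P : Matrix (Fin 3) (Fin 3) P3}
    (hP : P ∈ symPolyLE m) : koszul P ∈ symPolyLE n := by
  refine ⟨fun i j => ?_, fun i j => ?_⟩
  · simp only [koszul, of_apply]
    refine sum_mem fun s _ => sum_mem fun t _ => C_mul_mem _ ?_
    refine X_mul_mem (m := m + 1) (by omega) s (sum_mem fun k _ => sum_mem fun l _ => ?_)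
    exact C_mul_mem _ (X_mul_mem rfl l (hP.1 t k))
  · obtain ⟨h1, h2, h3, h4, h5, h6⟩ := eps_values
    have s10 := hP.2 1 0
    have s20 := hP.2 2 0
    have s21 := hP.2 2 1
    fin_cases i <;> fin_cases j <;>
    · simp [koszul, Fin.sum_univ_three, h1, h2, h3, h4, h5, h6, eps_self_left,
        eps_self_right, eps_self_outer, s10, s20, s21]
      try ring

theorem incPoly_mem {m n : ℤ} (hmn : m = n + 2) {P : Matrix (Fin 3) (Fin 3) P3}
    (hP : P ∈ symPolyLE m) : incPoly P ∈ symPolyLE n := by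
  refine ⟨fun i j => ?_, fun i j => ?_⟩
  · simp only [incPoly, LinearMap.coe_mk, AddHom.coe_mk, of_apply]
    refine sum_mem fun s _ => sum_mem fun t _ => C_mul_mem _ ?_
    refine pderiv_mem (m := n + 1) rfl s (sum_mem fun k _ => sum_mem fun l _ => ?_)
    exact C_mul_mem _ (pderiv_mem (by omega) l (hP.1 t k))
  · obtain ⟨h1, h2, h3, h4, h5, h6⟩ := eps_values
    have c10 := pderiv_comm 1 0
    have c20 := pderiv_comm 2 0
    have c21 := pderiv_comm 2 1
    have s10 := hP.2 1 0
    have s20 := hP.2 2 0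
    have s21 := hP.2 2 1
    fin_cases i <;> fin_cases j <;>
    · simp [incPoly, Fin.sum_univ_three, h1, h2, h3, h4, h5, h6, eps_self_left,
        eps_self_right, eps_self_outer, c10, c20, c21, s10, s20, s21]
      try ring

theorem symVecX_mem {m n : ℤ} (hmn : n = m + 1) {v : Fin 3 → P3} (hv : v ∈ vecPolyLE m) :
    symVecX v ∈ symPolyLE n := by
  rw [mem_vecPolyLE] at hv
  refine ⟨fun i j => C_mul_mem _ (add_mem ?_ ?_), fun i j => ?_⟩
  · rw [mul_comm]
    exact X_mul_mem hmn j (hv i)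
  · rw [mul_comm]
    exact X_mul_mem hmn i (hv j)
  · simp [symVecX, add_comm]

theorem exists_incPoly_eq {m n : ℤ} (hmn : m = n + 2) {P : Matrix (Fin 3) (Fin 3) P3}
    (hP : P ∈ symPolyLE n) (hdiv : divPoly P = 0) : ∃ Q ∈ symPolyLE m, incPoly Q = P := by
  set T : Matrix (Fin 3) (Fin 3) P3 := Matrix.of fun i j => eulerInv 2 (eulerInv 3 (P i j))
    with hT
  have hTmem : T ∈ symPolyLE n :=
    ⟨fun i j => eulerInv_mem _ (eulerInv_mem _ (hP.1 i j)), fun i j => by simp [hT, hP.2 i j]⟩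
  have hTdiv : divPoly T = 0 := by
    funext i
    have := congrFun hdiv i
    simp only [divPoly, Pi.zero_apply] at this
    simp [divPoly, hT, pderiv_eulerInv, ← map_sum, this]
  refine ⟨koszul T, koszul_mem hmn hTmem, ?_⟩
  ext1 i j
  rw [incPoly_koszul hTmem.2 hTdiv]
  simp only [hT, of_apply]
  rw [euler_eulerInv two_pos, euler_eulerInv three_pos]

/-- The matrix field defined by a matrix of polynomials. -/
def evalMat : Matrix (Fin 3) (Fin 3) P3 →ₗ[ℝ] (V3 → M3) where
  toFun P x := Matrix.of fun i j => eval x (P i j)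
  map_add' P Q := by
    funext x
    ext i j
    simp
  map_smul' a P := by
    funext x
    ext i j
    simp

theorem evalMat_injective : Function.Injective evalMat := by
  intro P Q h
  ext1 i j
  apply MvPolynomial.funext
  intro x
  exact congrFun (congrFun (congrFun h x) i) j

theorem polySym_iff {m : ℤ} {A : V3 → M3} :
    PolySym m A ↔ ∃ P ∈ symPolyLE m, A = evalMat P := by
  constructor
  · rintro ⟨hA, hsym⟩
    simp only [PolyMat, polyDeg_iff] at hA
    choose P hP hAP using hA
    refine ⟨Matrix.of P, ⟨hP, fun i j => ?_⟩, ?_⟩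
    · apply MvPolynomial.funext
      intro x
      have h := congrFun (congrFun (hsym x) j) i
      rw [transpose_apply] at h
      exact (congrFun (hAP i j) x).symm.trans (h.trans (congrFun (hAP j i) x))
    · funext x
      ext i j
      exact congrFun (hAP i j) x
  · rintro ⟨P, hP, rfl⟩
    refine ⟨fun i j => polyDeg_iff.mpr ⟨P i j, hP.1 i j, rfl⟩, fun x => ?_⟩
    ext i j
    simp [evalMat, hP.2 i j]

theorem incOp_evalMat (P : Matrix (Fin 3) (Fin 3) P3) :
    incOp (evalMat P) = evalMat (incPoly P) := by
  have h : rowCurl (evalMat P) =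
      evalMat (Matrix.of fun i j => ∑ k, ∑ l, C (eps j k l) * pderiv l (P i k)) := by
    funext x
    ext i j
    simp [rowCurl, evalMat, pd_eval]
  rw [incOp, h]
  funext x
  ext i j
  have hpd (s t) (Q : Matrix (Fin 3) (Fin 3) P3) :
      pd s (fun y => evalMat Q y t j) x = eval x (pderiv s (Q t j)) :=
    congrFun (pd_eval s (Q t j)) x
  simp only [colCurl, of_apply, hpd]
  simp only [evalMat, incPoly, LinearMap.coe_mk, AddHom.coe_mk, of_apply, eval_sum, eval_mul,
    eval_C]

theorem setOf_polySym (m : ℤ) :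
    {σ : V3 → M3 | PolySym m σ} = (symPolyLE m).map evalMat := by
  ext g
  simp [polySym_iff, eq_comm]

theorem setOf_incOp (m : ℤ) :
    {g : V3 → M3 | ∃ τ : V3 → M3, PolySym m τ ∧ g = incOp τ} =
      ((symPolyLE m).map incPoly).map evalMat := by
  ext g
  constructor
  · rintro ⟨τ, hτ, rfl⟩
    obtain ⟨P, hP, rfl⟩ := polySym_iff.mp hτ
    exact ⟨incPoly P, ⟨P, hP, rfl⟩, (incOp_evalMat P).symm⟩
  · rintro ⟨_, ⟨P, hP, rfl⟩, rfl⟩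
    exact ⟨evalMat P, polySym_iff.mpr ⟨P, hP, rfl⟩, (incOp_evalMat P).symm⟩

theorem symMat_vecMulVec_eval (v : Fin 3 → P3) :
    (fun x => symMat (vecMulVec (fun i => eval x (v i)) x)) = evalMat (symVecX v) := by
  funext x
  ext i j
  simp [symMat, vecMulVec_apply, evalMat, symVecX, mul_comm (x i)]

theorem setOf_symMat (m : ℤ) :
    {g : V3 → M3 | ∃ v : V3 → V3, PolyVec m v ∧ g = fun x => symMat (vecMulVec (v x) x)} =
      ((vecPolyLE m).map symVecX).map evalMat := by
  ext g
  constructor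
  · rintro ⟨v, hv, rfl⟩
    simp only [PolyVec, polyDeg_iff] at hv
    choose p hp hvp using hv
    refine ⟨symVecX p, ⟨p, mem_vecPolyLE.mpr hp, rfl⟩, ?_⟩
    rw [← symMat_vecMulVec_eval]
    funext x
    congr 2
    funext i
    exact (congrFun (hvp i) x).symm
  · rintro ⟨_, ⟨p, hp, rfl⟩, rfl⟩
    exact ⟨fun x i => eval x (p i),
      fun i => polyDeg_iff.mpr ⟨p i, mem_vecPolyLE.mp hp i, rfl⟩,
      (symMat_vecMulVec_eval p).symm⟩

/-- for `k ≥ 2`,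
`P_{k-2}(ℝ³;𝕊) = inc P_k(ℝ³;𝕊) ⊕ {x ↦ sym(v(x)xᵀ) : v ∈ P_{k-3}(ℝ³;ℝ³)}`. -/
theorem stmt_11 (k : ℕ) (hk : 2 ≤ k) :
    (Submodule.span ℝ
        {g : V3 → M3 | ∃ τ : V3 → M3, PolySym k τ ∧ g = incOp τ}) ⊓
      (Submodule.span ℝ
        {g : V3 → M3 | ∃ v : V3 → V3, PolyVec ((k : ℤ) - 3) v ∧
          g = fun x => symMat (Matrix.vecMulVec (v x) x)}) = ⊥ ∧
    (Submodule.span ℝ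
        {g : V3 → M3 | ∃ τ : V3 → M3, PolySym k τ ∧ g = incOp τ}) ⊔
      (Submodule.span ℝ
        {g : V3 → M3 | ∃ v : V3 → V3, PolyVec ((k : ℤ) - 3) v ∧
          g = fun x => symMat (Matrix.vecMulVec (v x) x)})
      = Submodule.span ℝ {σ : V3 → M3 | PolySym ((k : ℤ) - 2) σ} := by
  rw [setOf_incOp, setOf_symMat, setOf_polySym, Submodule.span_eq, Submodule.span_eq,
    Submodule.span_eq, ← Submodule.map_inf _ evalMat_injective, ← Submodule.map_sup]
  constructor
  · rw [eq_bot_iff]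
    rintro _ ⟨_, ⟨⟨P, -, hP⟩, v, -, rfl⟩, rfl⟩
    have h : divPoly (symVecX v) = 0 := by rw [← hP, divPoly_incPoly]
    simp [eq_zero_of_divPoly_symVecX_eq_zero h]
  · congr 1
    apply le_antisymm
    · refine sup_le ?_ ?_
      · rintro _ ⟨P, hP, rfl⟩
        exact incPoly_mem (by ring) hP
      · rintro _ ⟨v, hv, rfl⟩
        exact symVecX_mem (by ring) hv
    · intro P hP
      obtain ⟨v, hv, hdiv⟩ := exists_divPoly_symVecX_eq (m := (k : ℤ) - 3) (w := divPoly P)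
        fun i => sum_mem fun j _ => pderiv_mem (by ring) j (hP.1 i j)
      have hv' := mem_vecPolyLE.mpr hv
      have hR : divPoly (P - symVecX v) = 0 := by
        have := divPoly_add (P - symVecX v) (symVecX v)
        rw [sub_add_cancel, hdiv] at this
        simpa using this
      obtain ⟨Q, hQ, hQR⟩ := exists_incPoly_eq (m := k) (by ring)
        (sub_mem hP (symVecX_mem (by ring) hv')) hR
      rw [← sub_add_cancel P (symVecX v), ← hQR]
      exact Submodule.add_mem_sup ⟨Q, hQ, rfl⟩ ⟨v, hv', rfl⟩
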